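/- Let 𝒜_N(Ω) ⊆ 𝒜(Ω) be the discrete atomic set obtained by restricting the frequency f to the uniform grid {0, 1/N, …, (N−1)/N}, with induced atomic norm ‖·‖_{𝒜_N(Ω)} and dual norm ‖·‖*_{𝒜_N(Ω)}. Then for every w_Ω ∈ ℂ^L and N > π M̄: ‖w_Ω‖*_{𝒜_N(Ω)} ≤ ‖w_Ω‖*_{𝒜(Ω)} ≤ (1 − π M̄ / N)^{-1} ‖w_Ω‖*_{𝒜_N(Ω)}, where M̄ = Ω_L − Ω_1 + 1. -/

import Mathlib

open Complex Real

/-- Orthogonality of the `K`-th roots of unity for frequencies of modulus less than `K`. -/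
lemma sum_exp_range_eq_ite (K : ℕ) (m : ℤ) (hm : |m| < K) :
    ∑ s ∈ Finset.range K, cexp (2 * π * I * (m : ℂ) * ((s : ℂ) / (K : ℂ))) =
      if m = 0 then (K : ℂ) else 0 := by
  have hK : (K : ℂ) ≠ 0 := by
    have : (0 : ℤ) < K := lt_of_le_of_lt (abs_nonneg m) hm
    exact_mod_cast this.ne'
  split_ifs with h
  · simp [h]
  have hpow (s : ℕ) : cexp (2 * π * I * (m : ℂ) * ((s : ℂ) / (K : ℂ))) =
      cexp (2 * π * I * (m : ℂ) / (K : ℂ)) ^ s := by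
    rw [← Complex.exp_nat_mul]
    congr 1
    ring
  simp_rw [hpow]
  have hne : cexp (2 * π * I * (m : ℂ) / (K : ℂ)) ≠ 1 := by
    intro h1
    obtain ⟨k, hk⟩ := Complex.exp_eq_one_iff.mp h1
    have hmk : (m : ℂ) = k * K := by
      have h2 := Complex.two_pi_I_ne_zero
      field_simp at hk
      rw [hk, mul_comm]
    have hmk' : m = k * K := by exact_mod_cast hmk
    exact h (Int.eq_zero_of_abs_lt_dvd ⟨k, by rw [hmk', mul_comm]⟩ hm)
  rw [geom_sum_eq hne, ← Complex.exp_nat_mul,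
    show (K : ℂ) * (2 * π * I * (m : ℂ) / (K : ℂ)) = m * (2 * π * I) by field_simp,
    Complex.exp_int_mul_two_pi_mul_I]
  simp

/-- The squared modulus of the Dirichlet kernel as a double sum of exponentials. -/
lemma normSq_sum_exp_eq (M : ℕ) (x : ℝ) :
    ((‖∑ a ∈ Finset.range M, cexp (2 * π * I * (a : ℂ) * (x : ℂ))‖ ^ 2 : ℝ) : ℂ) =
      ∑ a ∈ Finset.range M, ∑ b ∈ Finset.range M,
        cexp (2 * π * I * (((b : ℤ) - (a : ℤ) : ℤ) : ℂ) * (x : ℂ)) := by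
  rw [Complex.ofReal_pow, ← Complex.conj_mul', map_sum, Finset.sum_mul_sum]
  refine Finset.sum_congr rfl fun a _ => Finset.sum_congr rfl fun b _ => ?_
  rw [← Complex.exp_conj, ← Complex.exp_add]
  congr 1
  simp only [map_mul, Complex.conj_ofReal, Complex.conj_I, map_ofNat, map_natCast]
  push_cast
  ring

/-- The Fejér kernel sampled on the `2M`-th roots of unity acts on the frequency `-n`,
`0 ≤ n < M`, as multiplication by `M - n`. -/
lemma sum_exp_mul_normSq_eq (M n : ℕ) (hn : n < M) :
    ∑ s ∈ Finset.range (2 * M),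
      cexp (-(2 * π * I * (n : ℂ) * (((s : ℝ) / ((2 * M : ℕ) : ℝ) : ℝ) : ℂ))) *
        ((‖∑ a ∈ Finset.range M,
          cexp (2 * π * I * (a : ℂ) * (((s : ℝ) / ((2 * M : ℕ) : ℝ) : ℝ) : ℂ))‖ ^ 2 : ℝ) : ℂ) =
      ((2 * M : ℕ) : ℂ) * ((M : ℂ) - n) := by
  simp_rw [normSq_sum_exp_eq, Finset.mul_sum]
  rw [Finset.sum_comm]
  have key : ∀ a ∈ Finset.range M, ∑ s ∈ Finset.range (2 * M), ∑ b ∈ Finset.range M,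
      cexp (-(2 * π * I * (n : ℂ) * (((s : ℝ) / ((2 * M : ℕ) : ℝ) : ℝ) : ℂ))) *
        cexp (2 * π * I * (((b : ℤ) - (a : ℤ) : ℤ) : ℂ) *
          (((s : ℝ) / ((2 * M : ℕ) : ℝ) : ℝ) : ℂ)) =
      if a < M - n then ((2 * M : ℕ) : ℂ) else 0 := by
    intro a ha
    rw [Finset.mem_range] at ha
    rw [Finset.sum_comm]
    have hb : ∀ b ∈ Finset.range M, ∑ s ∈ Finset.range (2 * M),
        cexp (-(2 * π * I * (n : ℂ) * (((s : ℝ) / ((2 * M : ℕ) : ℝ) : ℝ) : ℂ))) *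
          cexp (2 * π * I * (((b : ℤ) - (a : ℤ) : ℤ) : ℂ) *
            (((s : ℝ) / ((2 * M : ℕ) : ℝ) : ℝ) : ℂ)) =
        if b = a + n then ((2 * M : ℕ) : ℂ) else 0 := by
      intro b hb
      rw [Finset.mem_range] at hb
      have h := sum_exp_range_eq_ite (2 * M) ((b : ℤ) - a - n)
        (by rw [abs_lt]; push_cast; omega)
      have hiff : ((b : ℤ) - a - n = 0) ↔ b = a + n := by omega
      simp only [hiff] at h
      rw [← h]
      refine Finset.sum_congr rfl fun s _ => ?_
      rw [← Complex.exp_add]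
      congr 1
      push_cast
      ring
    rw [Finset.sum_congr rfl hb, Finset.sum_ite_eq']
    refine if_congr ?_ rfl rfl
    rw [Finset.mem_range]
    omega
  rw [Finset.sum_congr rfl key, ← Finset.sum_filter,
    Finset.sum_const, nsmul_eq_mul]
  have hcard : (Finset.filter (fun a => a < M - n) (Finset.range M)).card = M - n := by
    rw [show Finset.filter (fun a => a < M - n) (Finset.range M) = Finset.range (M - n) by
      ext a; simp only [Finset.mem_filter, Finset.mem_range]; omega, Finset.card_range]
  rw [hcard, Nat.cast_sub hn.le, mul_comm]

/-- A Bernstein-type inequality: the Fejér multiplier `M - n` has norm at most `M` on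
exponential sums with frequencies in `[0, M)`. -/
lemma norm_sum_sub_mul_exp_le {ι : Type*} [Fintype ι] (c : ι → ℂ) (n : ι → ℕ) (M : ℕ)
    (hn : ∀ j, n j < M) (S : ℝ)
    (hS : ∀ x : ℝ, ‖∑ j, c j * cexp (-(2 * π * I * (n j : ℂ) * (x : ℂ)))‖ ≤ S) (x : ℝ) :
    ‖∑ j, c j * ((M : ℂ) - n j) * cexp (-(2 * π * I * (n j : ℂ) * (x : ℂ)))‖ ≤ M * S := by
  rcases Nat.eq_zero_or_pos M with rfl | hM
  · have : IsEmpty ι := ⟨fun j => absurd (hn j) (Nat.not_lt_zero _)⟩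
    simp
  set K : ℕ := 2 * M with hK
  have hKpos : (0 : ℝ) < K := by exact_mod_cast (by omega : 0 < K)
  let t : ℕ → ℝ := fun s => (s : ℝ) / (K : ℝ)
  let W : ℕ → ℝ := fun s =>
    ‖∑ a ∈ Finset.range M, cexp (2 * π * I * (a : ℂ) * (t s : ℂ))‖ ^ 2
  have hmult (k : ℕ) (hk : k < M) :
      ∑ s ∈ Finset.range K, cexp (-(2 * π * I * (k : ℂ) * (t s : ℂ))) * (W s : ℂ) =
        (K : ℂ) * ((M : ℂ) - k) := sum_exp_mul_normSq_eq M k hk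
  have hmass : ∑ s ∈ Finset.range K, W s = K * M := by
    have h := hmult 0 hM
    simp only [Nat.cast_zero, mul_zero, zero_mul, neg_zero, Complex.exp_zero, one_mul,
      sub_zero] at h
    exact_mod_cast h
  have hrep : (K : ℂ) *
      ∑ j, c j * ((M : ℂ) - n j) * cexp (-(2 * π * I * (n j : ℂ) * (x : ℂ))) =
      ∑ s ∈ Finset.range K,
        (∑ j, c j * cexp (-(2 * π * I * (n j : ℂ) * ((x + t s : ℝ) : ℂ)))) * (W s : ℂ) := by
    simp_rw [Finset.sum_mul]
    rw [Finset.sum_comm, Finset.mul_sum]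
    refine Finset.sum_congr rfl fun j _ => ?_
    calc (K : ℂ) * (c j * ((M : ℂ) - n j) * cexp (-(2 * π * I * (n j : ℂ) * (x : ℂ))))
        = c j * cexp (-(2 * π * I * (n j : ℂ) * (x : ℂ))) * ((K : ℂ) * ((M : ℂ) - n j)) := by
          ring
      _ = _ := by
          rw [← hmult (n j) (hn j), Finset.mul_sum]
          refine Finset.sum_congr rfl fun s _ => ?_
          rw [show -(2 * π * I * (n j : ℂ) * ((x + t s : ℝ) : ℂ)) =
            -(2 * π * I * (n j : ℂ) * (x : ℂ)) + -(2 * π * I * (n j : ℂ) * (t s : ℂ)) by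
              push_cast; ring, Complex.exp_add]
          ring
  have hle : (K : ℝ) *
      ‖∑ j, c j * ((M : ℂ) - n j) * cexp (-(2 * π * I * (n j : ℂ) * (x : ℂ)))‖ ≤
      K * (M * S) := by
    calc _ = ‖(K : ℂ) *
          ∑ j, c j * ((M : ℂ) - n j) * cexp (-(2 * π * I * (n j : ℂ) * (x : ℂ)))‖ := by
          rw [norm_mul, Complex.norm_natCast]
      _ ≤ ∑ s ∈ Finset.range K, S * W s := by
          rw [hrep]
          refine norm_sum_le_of_le _ fun s _ => ?_
          have hW : 0 ≤ W s := by positivity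
          rw [norm_mul, Complex.norm_real, Real.norm_of_nonneg hW]
          exact mul_le_mul_of_nonneg_right (hS _) hW
      _ = K * (M * S) := by
          rw [← Finset.mul_sum, hmass]
          ring
  exact le_of_mul_le_mul_left hle hKpos

/-- The dual polynomial of `w`, i.e. the pairing of `w` with the atom of frequency `f`. -/
noncomputable def dualPoly {L : ℕ} (Ω : Fin L → ℕ) (w : Fin L → ℂ) (f : ℝ) : ℂ :=
  ∑ j, (starRingEnd ℂ) (cexp (2 * π * I * (Ω j : ℂ) * (f : ℂ))) * w j

lemma dualPoly_eq {L : ℕ} (Ω : Fin L → ℕ) (w : Fin L → ℂ) (f : ℝ) :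
    dualPoly Ω w f = ∑ j, w j * cexp (-(2 * π * I * (Ω j : ℂ) * (f : ℂ))) := by
  refine Finset.sum_congr rfl fun j _ => ?_
  rw [← Complex.exp_conj, mul_comm]
  congr 2
  simp only [map_mul, Complex.conj_ofReal, Complex.conj_I, map_ofNat, map_natCast]
  ring

lemma dualPoly_add_int {L : ℕ} (Ω : Fin L → ℕ) (w : Fin L → ℂ) (f : ℝ) (k : ℤ) :
    dualPoly Ω w (f + k) = dualPoly Ω w f := by
  rw [dualPoly_eq, dualPoly_eq]
  refine Finset.sum_congr rfl fun j _ => ?_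
  rw [show -(2 * π * I * (Ω j : ℂ) * ((f + k : ℝ) : ℂ)) =
    -(2 * π * I * (Ω j : ℂ) * (f : ℂ)) + ((-(Ω j * k) : ℤ) : ℂ) * (2 * π * I) by
      push_cast; ring, Complex.exp_add, Complex.exp_int_mul_two_pi_mul_I, mul_one]

/-- Multiplying the dual polynomial by a character shifts its frequencies. -/
lemma norm_dualPoly_eq_of_shift {L : ℕ} (Ω n : Fin L → ℕ) (w : Fin L → ℂ) (p : ℕ)
    (h : ∀ j, Ω j = p + n j) (x : ℝ) :
    ‖∑ j, w j * cexp (-(2 * π * I * (n j : ℂ) * (x : ℂ)))‖ = ‖dualPoly Ω w x‖ := by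
  have hu : ‖cexp (((-(2 * π * p * x) : ℝ) : ℂ) * I)‖ = 1 := Complex.norm_exp_ofReal_mul_I _
  rw [← one_mul ‖∑ j, w j * cexp (-(2 * π * I * (n j : ℂ) * (x : ℂ)))‖, ← hu, ← norm_mul,
    dualPoly_eq, Finset.mul_sum]
  congr 1
  refine Finset.sum_congr rfl fun j _ => ?_
  rw [mul_left_comm, ← Complex.exp_add, h j]
  congr 2
  push_cast
  ring

/-- The modulus of the dual polynomial is Lipschitz with constant `2πM` times its supremum. -/
lemma norm_dualPoly_le_add {L : ℕ} (Ω n : Fin L → ℕ) (w : Fin L → ℂ) (p M : ℕ)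
    (h : ∀ j, Ω j = p + n j) (hn : ∀ j, n j < M) (S : ℝ)
    (hS : ∀ x, ‖dualPoly Ω w x‖ ≤ S) (x y : ℝ) :
    ‖dualPoly Ω w x‖ ≤ ‖dualPoly Ω w y‖ + 2 * π * (M * S) * |x - y| := by
  let R : ℝ → ℂ := fun f => ∑ j, w j * cexp (2 * π * I * ((M : ℂ) - n j) * (f : ℂ))
  let R' : ℝ → ℂ := fun f =>
    ∑ j, w j * (cexp (2 * π * I * ((M : ℂ) - n j) * (f : ℂ)) * (2 * π * I * ((M : ℂ) - n j)))
  have hR (f : ℝ) : R f = cexp (((2 * π * M * f : ℝ) : ℂ) * I) *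
      ∑ j, w j * cexp (-(2 * π * I * (n j : ℂ) * (f : ℂ))) := by
    rw [Finset.mul_sum]
    refine Finset.sum_congr rfl fun j _ => ?_
    rw [mul_left_comm, ← Complex.exp_add]
    congr 2
    push_cast
    ring
  have hRn (f : ℝ) : ‖R f‖ = ‖dualPoly Ω w f‖ := by
    rw [hR, norm_mul, Complex.norm_exp_ofReal_mul_I, one_mul, norm_dualPoly_eq_of_shift Ω n w p h]
  have hR' (f : ℝ) : R' f = (2 * π * I) * (cexp (((2 * π * M * f : ℝ) : ℂ) * I) *
      ∑ j, w j * ((M : ℂ) - n j) * cexp (-(2 * π * I * (n j : ℂ) * (f : ℂ)))) := by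
    rw [Finset.mul_sum, Finset.mul_sum]
    refine Finset.sum_congr rfl fun j _ => ?_
    rw [show 2 * π * I * ((M : ℂ) - n j) * (f : ℂ) =
      ((2 * π * M * f : ℝ) : ℂ) * I + -(2 * π * I * (n j : ℂ) * (f : ℂ)) by push_cast; ring,
      Complex.exp_add]
    ring
  have hderiv (f : ℝ) : HasDerivAt R (R' f) f := by
    refine HasDerivAt.fun_sum fun j _ => HasDerivAt.const_mul _ (HasDerivAt.cexp ?_)
    simpa using (Complex.ofRealCLM.hasDerivAt (x := f)).const_mul (2 * π * I * ((M : ℂ) - n j))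
  have hbound (f : ℝ) : ‖R' f‖ ≤ 2 * π * (M * S) := by
    rw [hR', norm_mul, norm_mul (cexp _), Complex.norm_exp_ofReal_mul_I, one_mul]
    have h2 : ‖(2 * π * I : ℂ)‖ = 2 * π := by
      simp [abs_of_pos Real.pi_pos]
    rw [h2]
    refine mul_le_mul_of_nonneg_left ?_ (by positivity)
    refine norm_sum_sub_mul_exp_le w n M hn S (fun x => ?_) f
    rw [norm_dualPoly_eq_of_shift Ω n w p h]
    exact hS x
  have hmv := convex_univ.norm_image_sub_le_of_norm_hasDerivWithin_le (f := R) (f' := R')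
    (C := 2 * π * (M * S)) (x := y) (y := x)
    (fun f _ => (hderiv f).hasDerivWithinAt) (fun f _ => hbound f) trivial trivial
  rw [Real.norm_eq_abs] at hmv
  rw [← hRn x, ← hRn y]
  linarith [norm_sub_norm_le (R x) (R y)]

lemma sum_conj_mul_eq {L : ℕ} (Ω : Fin L → ℕ) (w : Fin L → ℂ) (φ : ℂ) (f : ℝ) :
    ∑ j, (starRingEnd ℂ) (φ * cexp (2 * π * I * (Ω j : ℂ) * (f : ℂ))) * w j =
      (starRingEnd ℂ) φ * dualPoly Ω w f := by
  rw [dualPoly, Finset.mul_sum]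
  refine Finset.sum_congr rfl fun j _ => ?_
  rw [map_mul, mul_assoc]

lemma re_conj_mul_le_norm (φ z : ℂ) (hφ : ‖φ‖ = 1) : ((starRingEnd ℂ) φ * z).re ≤ ‖z‖ := by
  refine (Complex.re_le_norm _).trans_eq ?_
  rw [norm_mul, Complex.norm_conj, hφ, one_mul]

lemma exists_norm_eq_re_conj_mul (z : ℂ) :
    ∃ φ : ℂ, ‖φ‖ = 1 ∧ ‖z‖ = ((starRingEnd ℂ) φ * z).re := by
  rcases eq_or_ne z 0 with rfl | hz
  · exact ⟨1, by simp⟩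
  have hz' : (‖z‖ : ℂ) ≠ 0 := by simpa using hz
  refine ⟨z / ‖z‖, by simp [hz], ?_⟩
  have : (starRingEnd ℂ) (z / ‖z‖) * z = (‖z‖ : ℂ) := by
    rw [map_div₀, Complex.conj_ofReal, div_mul_eq_mul_div, Complex.conj_mul']
    field_simp
  rw [this, Complex.ofReal_re]

lemma norm_dualPoly_le {L : ℕ} (Ω : Fin L → ℕ) (w : Fin L → ℂ) (f : ℝ) :
    ‖dualPoly Ω w f‖ ≤ ∑ j, ‖w j‖ := by
  refine norm_sum_le_of_le _ fun j _ => ?_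
  rw [norm_mul, Complex.norm_conj,
    show 2 * π * I * (Ω j : ℂ) * (f : ℂ) = ((2 * π * Ω j * f : ℝ) : ℂ) * I by push_cast; ring,
    Complex.norm_exp_ofReal_mul_I, one_mul]

/-- Comparison of the continuous and grid-based dual atomic norms for sampled sinusoids on the
index set `Ω` (with sampling range `Mbar = Ω_L − Ω_1 + 1`):
`‖w‖*_{𝒜_N(Ω)} ≤ ‖w‖*_{𝒜(Ω)} ≤ (1 − πMbar/N)⁻¹ ‖w‖*_{𝒜_N(Ω)}` for `N > πMbar`. -/
theorem dualAtomicNorm_grid_le_cont_le (L : ℕ) (hL : 0 < L)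
    (Ω : Fin L → ℕ) (hΩ : StrictMono Ω) (Mbar : ℕ)
    (hM : Mbar = Ω ⟨L - 1, Nat.sub_lt hL Nat.one_pos⟩ + 1 - Ω ⟨0, hL⟩)
    (N : ℕ) (hN : Real.pi * (Mbar : ℝ) < (N : ℝ)) (w : Fin L → ℂ) :
    sSup {r : ℝ | ∃ m : Fin N, ∃ φ : ℂ, ‖φ‖ = 1 ∧
        r = (∑ j : Fin L, (starRingEnd ℂ)
          (φ * Complex.exp (2 * π * I * (Ω j : ℂ) * (((m : ℕ) : ℂ) / (N : ℂ)))) * w j).re}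
      ≤ sSup {r : ℝ | ∃ f ∈ Set.Ico (0 : ℝ) 1, ∃ φ : ℂ, ‖φ‖ = 1 ∧
        r = (∑ j : Fin L, (starRingEnd ℂ)
          (φ * Complex.exp (2 * π * I * (Ω j : ℂ) * (f : ℂ))) * w j).re}
    ∧
    sSup {r : ℝ | ∃ f ∈ Set.Ico (0 : ℝ) 1, ∃ φ : ℂ, ‖φ‖ = 1 ∧
        r = (∑ j : Fin L, (starRingEnd ℂ)
          (φ * Complex.exp (2 * π * I * (Ω j : ℂ) * (f : ℂ))) * w j).re}
      ≤ (1 - Real.pi * (Mbar : ℝ) / (N : ℝ))⁻¹ *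
        sSup {r : ℝ | ∃ m : Fin N, ∃ φ : ℂ, ‖φ‖ = 1 ∧
          r = (∑ j : Fin L, (starRingEnd ℂ)
            (φ * Complex.exp (2 * π * I * (Ω j : ℂ) * (((m : ℕ) : ℂ) / (N : ℂ)))) * w j).re} := by
  have hcast (m : ℕ) : ((m : ℂ) / (N : ℂ)) = (((m : ℝ) / (N : ℝ) : ℝ) : ℂ) := by push_cast; rfl
  simp_rw [hcast, sum_conj_mul_eq]
  set A : Set ℝ := {r : ℝ | ∃ m : Fin N, ∃ φ : ℂ, ‖φ‖ = 1 ∧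
    r = ((starRingEnd ℂ) φ * dualPoly Ω w (((m : ℕ) : ℝ) / (N : ℝ))).re} with hA
  set B : Set ℝ := {r : ℝ | ∃ f ∈ Set.Ico (0 : ℝ) 1, ∃ φ : ℂ, ‖φ‖ = 1 ∧
    r = ((starRingEnd ℂ) φ * dualPoly Ω w f).re} with hB
  have hNpos : (0 : ℝ) < N := lt_of_le_of_lt (by positivity) hN
  have hNnat : 0 < N := by exact_mod_cast hNpos
  have hAB : A ⊆ B := by
    rintro r ⟨m, φ, hφ, rfl⟩
    refine ⟨_, ⟨by positivity, ?_⟩, φ, hφ, rfl⟩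
    rw [div_lt_one hNpos]
    exact_mod_cast m.2
  have hBbdd : BddAbove B := by
    refine ⟨∑ j, ‖w j‖, ?_⟩
    rintro r ⟨f, -, φ, hφ, rfl⟩
    exact (re_conj_mul_le_norm φ _ hφ).trans (norm_dualPoly_le Ω w f)
  have hgrid (m : ℤ) : ‖dualPoly Ω w ((m : ℝ) / (N : ℝ))‖ ≤ sSup A := by
    obtain ⟨φ, hφ, heq⟩ := exists_norm_eq_re_conj_mul (dualPoly Ω w ((m : ℝ) / (N : ℝ)))
    have hN0 : (0 : ℤ) < N := by exact_mod_cast hNnat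
    obtain ⟨k, hk⟩ := Int.eq_ofNat_of_zero_le (Int.emod_nonneg m hN0.ne')
    have hkN : k < N := by have := Int.emod_lt_of_pos m hN0; omega
    have hm : (m : ℝ) / N = (k : ℝ) / N + ((m / N : ℤ) : ℝ) := by
      have h1 : m = k + N * (m / N) := by
        have := Int.emod_add_mul_ediv m N
        omega
      have h2 : (m : ℝ) = k + N * ((m / N : ℤ) : ℝ) := by exact_mod_cast h1
      field_simp
      exact h2
    rw [heq]
    refine le_csSup (hBbdd.mono hAB) ⟨⟨k, hkN⟩, φ, hφ, ?_⟩
    rw [hm, dualPoly_add_int]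
  have hcont (f : ℝ) : ‖dualPoly Ω w f‖ ≤ sSup B := by
    obtain ⟨φ, hφ, heq⟩ := exists_norm_eq_re_conj_mul (dualPoly Ω w f)
    rw [heq]
    refine le_csSup hBbdd ⟨Int.fract f, ⟨Int.fract_nonneg f, Int.fract_lt_one f⟩, φ, hφ, ?_⟩
    conv_lhs => rw [← Int.fract_add_floor f, dualPoly_add_int]
  have hAne : A.Nonempty := ⟨_, ⟨0, hNnat⟩, 1, norm_one, rfl⟩
  refine ⟨csSup_le_csSup hBbdd hAne hAB, ?_⟩
  have hΩ0 (j : Fin L) : Ω ⟨0, hL⟩ ≤ Ω j := hΩ.monotone (Fin.mk_le_of_le_val (Nat.zero_le _))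
  have hΩL (j : Fin L) : Ω j ≤ Ω ⟨L - 1, Nat.sub_lt hL Nat.one_pos⟩ :=
    hΩ.monotone (Fin.le_def.mpr (Nat.le_sub_one_of_lt j.2))
  have hlip := norm_dualPoly_le_add Ω (fun j => Ω j - Ω ⟨0, hL⟩) w (Ω ⟨0, hL⟩) Mbar
    (fun j => by have := hΩ0 j; omega)
    (fun j => by have := hΩ0 j; have := hΩL j; show Ω j - _ < Mbar; omega) (sSup B) hcont
  have hBnonneg : 0 ≤ sSup B := (norm_nonneg _).trans (hcont 0)
  have hmain : sSup B ≤ sSup A + Real.pi * Mbar / N * sSup B := by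
    refine csSup_le (hAne.mono hAB) ?_
    rintro r ⟨f, -, φ, hφ, rfl⟩
    refine (re_conj_mul_le_norm φ _ hφ).trans ((hlip f (round (f * N) / N)).trans ?_)
    refine add_le_add (hgrid _) ?_
    have hdist : |f - round (f * N) / N| ≤ 1 / 2 / N := by
      rw [show f - round (f * N) / N = (f * N - round (f * N)) / N by field_simp, abs_div,
        abs_of_pos hNpos]
      exact div_le_div_of_nonneg_right (abs_sub_round _) hNpos.le
    calc 2 * π * (Mbar * sSup B) * |f - round (f * N) / N|
        ≤ 2 * π * (Mbar * sSup B) * (1 / 2 / N) :=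
          mul_le_mul_of_nonneg_left hdist (by positivity)
      _ = Real.pi * Mbar / N * sSup B := by ring
  have hpos : 0 < 1 - Real.pi * (Mbar : ℝ) / (N : ℝ) := by
    rw [sub_pos, div_lt_one hNpos]
    exact hN
  rw [inv_mul_eq_div, le_div_iff₀ hpos]
  linarith
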